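/- Let X ⊆ ℝⁿ be nonempty and compact, U : ℝⁿ → ℝ^N and f : ℝ^N → ℝ continuous, γ > 0, and W₁, W₂ nonempty compact subsets of ℝ^N with ν_k(u) = sup_{w ∈ W_k} ν_w(u). For k ∈ {1,2} let x*_k be a minimizer over X of f(U(x)) + γ·ν_k(U(x)), let w*_k ∈ W_k be a maximizer of ν_w(U(x*_k)) over w ∈ W_k, and suppose there exists τ_k > 0 such that for all x ∈ X: f(U(x)) + γ·ν_{w*_k}(U(x)) − f(U(x*_k)) − γ·ν_{w*_k}(U(x*_k)) ≥ τ_k · ‖x − x*_k‖₂² (quadratic growth). Let U_max = max_{x ∈ X} ‖U(x)‖₂. Then ‖x*₁ − x*₂‖₂ ≤ sqrt( γ·U_max / min{τ₁, τ₂} ) · d_H(W₁, W₂)^{1/2}. -/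

import Mathlib

/-- The nondecreasing rearrangement of `u ∈ ℝ^N` (with the Euclidean structure):
`sortedVecE u i` is the `i`-th smallest entry. -/
noncomputable def sortedVecE {N : ℕ} (u : EuclideanSpace ℝ (Fin N)) : Fin N → ℝ :=
  (fun i => u i) ∘ Tuple.sort (fun i => u i)

/-- The order-based functional `ν_w(u) = Σ_i w_i u_(i)`. -/
noncomputable def nuwE {N : ℕ} (w u : EuclideanSpace ℝ (Fin N)) : ℝ :=
  ∑ i, w i * sortedVecE u i

theorem norm_toLp_sortedVecE {N : ℕ} (u : EuclideanSpace ℝ (Fin N)) :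
    ‖WithLp.toLp 2 (sortedVecE u)‖ = ‖u‖ := by
  rw [EuclideanSpace.norm_eq, EuclideanSpace.norm_eq]
  congr 1
  exact Equiv.sum_comp (Tuple.sort (fun i => u i)) (fun i => ‖u i‖ ^ 2)

theorem nuwE_sub_le {N : ℕ} (v w u : EuclideanSpace ℝ (Fin N)) :
    nuwE v u - nuwE w u ≤ dist v w * ‖u‖ := by
  have h := real_inner_le_norm (WithLp.toLp 2 (sortedVecE u)) (v - w)
  rw [norm_toLp_sortedVecE, ← dist_eq_norm, mul_comm] at h
  refine le_trans (le_of_eq ?_) h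
  simp [nuwE, PiLp.inner_apply, ← Finset.sum_sub_distrib, sub_mul]

/-- A functional in one compact family exceeds an upper bound of the other family by at most the
Hausdorff distance of the families times the norm. -/
theorem nuwE_sub_le_hausdorffDist {N : ℕ} {V W : Set (EuclideanSpace ℝ (Fin N))}
    (hV : IsCompact V) (hW : IsCompact W) (hWne : W.Nonempty)
    {v u : EuclideanSpace ℝ (Fin N)} (hv : v ∈ V) {c : ℝ} (hc : ∀ w ∈ W, nuwE w u ≤ c) :
    nuwE v u - c ≤ Metric.hausdorffDist V W * ‖u‖ := by
  obtain ⟨w, hw, hvw⟩ := hW.exists_infDist_eq_dist hWne v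
  have hdist : dist v w ≤ Metric.hausdorffDist V W := hvw ▸
    Metric.infDist_le_hausdorffDist_of_mem hv
      (Metric.hausdorffEDist_ne_top_of_nonempty_of_bounded ⟨v, hv⟩ hWne hV.isBounded hW.isBounded)
  have h := mul_le_mul_of_nonneg_right hdist (norm_nonneg u)
  linarith [nuwE_sub_le v w u, hc w hw]

/-- Stability of the optimal solution: under quadratic growth with constants `τ₁, τ₂ > 0`,
the minimizers `x*₁, x*₂` of `f(U(x)) + γ ν_k(U(x))` over `X` satisfy
`‖x*₁ − x*₂‖₂ ≤ sqrt(γ U_max / min{τ₁,τ₂}) · d_H(W₁,W₂)^{1/2}`. -/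
theorem stmt16 {n N : ℕ} (X : Set (EuclideanSpace ℝ (Fin n)))
    (hX : X.Nonempty) (hXc : IsCompact X)
    (U : EuclideanSpace ℝ (Fin n) → EuclideanSpace ℝ (Fin N)) (hU : Continuous U)
    (f : EuclideanSpace ℝ (Fin N) → ℝ) (hf : Continuous f)
    (γ : ℝ) (hγ : 0 < γ)
    (W₁ W₂ : Set (EuclideanSpace ℝ (Fin N)))
    (h1 : W₁.Nonempty) (h2 : W₂.Nonempty) (hc1 : IsCompact W₁) (hc2 : IsCompact W₂)
    (x₁ x₂ : EuclideanSpace ℝ (Fin n)) (hx₁ : x₁ ∈ X) (hx₂ : x₂ ∈ X)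
    (hmin₁ : ∀ x ∈ X, f (U x₁) + γ * sSup ((fun w => nuwE w (U x₁)) '' W₁) ≤
      f (U x) + γ * sSup ((fun w => nuwE w (U x)) '' W₁))
    (hmin₂ : ∀ x ∈ X, f (U x₂) + γ * sSup ((fun w => nuwE w (U x₂)) '' W₂) ≤
      f (U x) + γ * sSup ((fun w => nuwE w (U x)) '' W₂))
    (w₁ : EuclideanSpace ℝ (Fin N)) (hw₁ : w₁ ∈ W₁)
    (hw₁max : ∀ w ∈ W₁, nuwE w (U x₁) ≤ nuwE w₁ (U x₁))
    (w₂ : EuclideanSpace ℝ (Fin N)) (hw₂ : w₂ ∈ W₂)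
    (hw₂max : ∀ w ∈ W₂, nuwE w (U x₂) ≤ nuwE w₂ (U x₂))
    (τ₁ τ₂ : ℝ) (hτ₁ : 0 < τ₁) (hτ₂ : 0 < τ₂)
    (hqg₁ : ∀ x ∈ X, τ₁ * ‖x - x₁‖ ^ 2 ≤
      f (U x) + γ * nuwE w₁ (U x) - f (U x₁) - γ * nuwE w₁ (U x₁))
    (hqg₂ : ∀ x ∈ X, τ₂ * ‖x - x₂‖ ^ 2 ≤
      f (U x) + γ * nuwE w₂ (U x) - f (U x₂) - γ * nuwE w₂ (U x₂)) :
    ‖x₁ - x₂‖ ≤ Real.sqrt (γ * sSup ((fun x => ‖U x‖) '' X) / min τ₁ τ₂) *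
      Real.sqrt (Metric.hausdorffDist W₁ W₂) := by
  set D := Metric.hausdorffDist W₁ W₂
  set M := sSup ((fun x => ‖U x‖) '' X)
  have hD0 : 0 ≤ D := Metric.hausdorffDist_nonneg
  have hUM : ∀ x ∈ X, ‖U x‖ ≤ M := fun x hx =>
    le_csSup (hXc.image hU.norm).bddAbove (Set.mem_image_of_mem _ hx)
  have hM0 : 0 ≤ M := (norm_nonneg _).trans (hUM x₁ hx₁)
  have hτ : 0 < min τ₁ τ₂ := lt_min hτ₁ hτ₂
  have hν₁ := nuwE_sub_le_hausdorffDist hc1 hc2 h2 hw₁ hw₂max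
  have hν₂ := nuwE_sub_le_hausdorffDist hc2 hc1 h1 hw₂ hw₁max
  rw [Metric.hausdorffDist_comm] at hν₂
  have hDM₁ := mul_le_mul_of_nonneg_left (hUM x₁ hx₁) hD0
  have hDM₂ := mul_le_mul_of_nonneg_left (hUM x₂ hx₂) hD0
  have hq₁ := hqg₁ x₂ hx₂
  have hq₂ := hqg₂ x₁ hx₁
  rw [norm_sub_rev] at hq₁
  have hm₁ := mul_le_mul_of_nonneg_right (min_le_left τ₁ τ₂) (sq_nonneg ‖x₁ - x₂‖)
  have hm₂ := mul_le_mul_of_nonneg_right (min_le_right τ₁ τ₂) (sq_nonneg ‖x₁ - x₂‖)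
  have hγ₁ := mul_le_mul_of_nonneg_left (hν₁.trans hDM₂) hγ.le
  have hγ₂ := mul_le_mul_of_nonneg_left (hν₂.trans hDM₁) hγ.le
  have key : min τ₁ τ₂ * ‖x₁ - x₂‖ ^ 2 ≤ γ * M * D := by linarith
  rw [← Real.sqrt_mul (by positivity)]
  apply Real.le_sqrt_of_sq_le
  rw [div_mul_eq_mul_div, le_div_iff₀ hτ]
  linarith
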